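/- (Proposition 4, SLiC failure.) Assume the dichotomy data model with query size k = 2, ζ = P_π̄(M1) ∈ (0,1), and p*(1), p*(2) > 0, where the parameters k, ζ, p* and the set M1 are held fixed while |M2| varies, so that the joint distribution of the per-datum category counts and chosen categories does not depend on |M2|. For each dataset size n and each value of |M2|, let θ̂ minimize L_SLiC(π_θ) over θ ∈ ℝ². Then lim_{n→∞} P( lim_{|M2|→∞} P_{π_θ̂}(M1) = 0 ) = 1, where the inner limit is taken with the realized category/choice pattern of the dataset held fixed. -/

import Mathlib

open MeasureTheory Filter Finset Real

/-- Number of category-1 messages in a query, given the vector of category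
indicators of its messages (`true` = category 1). -/
def catCount {k : ℕ} (v : Fin k → Bool) : ℕ := (Finset.univ.filter fun j => v j = true).card

/-- Probability that the chosen message is of category 1, given the category
pattern `v` of the query: the annotator's type is 1 with probability `p1`; the
choice is uniform on the messages of the annotator's category if present, and
uniform on the whole query otherwise. -/
noncomputable def chooseCat1Prob {k : ℕ} (p1 : ℝ) (v : Fin k → Bool) : ℝ :=
  if ∀ j, v j = true then 1 else if ∃ j, v j = true then p1 else 0

/-- Probability of a single datum pattern `(v, c)` in the dichotomy data model
with query size `2`:  `v j` is the category indicator of the `j`-th message of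
the query (each message is of category 1 independently with probability
`ζ = P_π̄(M1)`), and `c` is the category of the chosen message.  This joint
distribution does not depend on `|M2|`. -/
noncomputable def datumProb {k : ℕ} (ζ p1 : ℝ) (d : (Fin k → Bool) × Bool) : ℝ :=
  (∏ j, if d.1 j then ζ else 1 - ζ) *
    (if d.2 then chooseCat1Prob p1 d.1 else 1 - chooseCat1Prob p1 d.1)

/-- Total probability `P_{π_θ}(M1)` assigned by the policy `π_θ` to the `m1`
category-1 messages, for the two-parameter policy architecture
`P_{π_θ}(x) = e^{θ_z}/(m1 e^{θ1} + m2 e^{θ2})` for `x` of category `z`. -/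
noncomputable def polM1 (m1 m2 : ℕ) (θ : ℝ × ℝ) : ℝ :=
  m1 * exp θ.1 / (m1 * exp θ.1 + m2 * exp θ.2)

/-- Total probability `P_{π_θ}(M2)` assigned by the policy `π_θ` to the `m2`
category-2 messages. -/
noncomputable def polM2 (m1 m2 : ℕ) (θ : ℝ × ℝ) : ℝ :=
  m2 * exp θ.2 / (m1 * exp θ.1 + m2 * exp θ.2)

/-- The SLiC loss
`L_SLiC(π_θ) = Σ_{(Y,y)∈D} max(0, ln(P_{π_θ}(y')/P_{π_θ}(y)) + δ) + β KL(P_{π_θ} ‖ P_π̄)`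
for pairwise queries (`y'` the non-chosen message of the pair), written in terms
of the dataset's category pattern:  when the two messages of a query are in
different categories (`catCount = 1`), the log-ratio of per-message policy
probabilities is `θ2 - θ1` if category 1 was chosen, and `θ1 - θ2` otherwise;
when both messages are of the same category the ratio is one. -/
noncomputable def slicLoss (m1 m2 : ℕ) (ζ β δ : ℝ) {n : ℕ}
    (d : Fin n → (Fin 2 → Bool) × Bool) (θ : ℝ × ℝ) : ℝ :=
  (∑ i, if catCount (d i).1 = 1
      then max 0 ((if (d i).2 then θ.2 - θ.1 else θ.1 - θ.2) + δ)
      else max 0 (0 + δ)) +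
    β * (polM1 m1 m2 θ * log (polM1 m1 m2 θ / ζ) +
      polM2 m1 m2 θ * log (polM2 m1 m2 θ / (1 - ζ)))

/-- Lower bound for one summand of a Kullback-Leibler divergence. -/
lemma sub_le_mul_log_div {q r : ℝ} (hq : 0 ≤ q) (hr : 0 < r) : q - r ≤ q * log (q / r) := by
  rcases hq.eq_or_lt with rfl | hq
  · simp [hr.le]
  · have h := one_sub_inv_le_log_of_pos (div_pos hq hr)
    calc q - r = q * (1 - (q / r)⁻¹) := by field_simp
      _ ≤ q * log (q / r) := mul_le_mul_of_nonneg_left h hq.le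

/-- Upper bound for one summand of a Kullback-Leibler divergence. -/
lemma mul_log_div_le_neg_log {q r : ℝ} (hq : 0 ≤ q) (hq1 : q ≤ 1) (hr : 0 < r) (hr1 : r ≤ 1) :
    q * log (q / r) ≤ -log r := by
  have hlog := log_nonpos hr.le hr1
  rcases hq.eq_or_lt with rfl | hq
  · simpa using hlog
  · rw [log_div hq.ne' hr.ne']
    nlinarith [log_nonpos hq.le hq1]

lemma polM1_mem_Icc (m1 m2 : ℕ) (θ : ℝ × ℝ) : polM1 m1 m2 θ ∈ Set.Icc (0 : ℝ) 1 := by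
  have h1 : 0 ≤ m1 * exp θ.1 := by positivity
  have h2 : 0 ≤ m2 * exp θ.2 := by positivity
  exact ⟨div_nonneg h1 (by positivity), div_le_one_of_le₀ (by linarith) (by positivity)⟩

lemma polM2_mem_Icc (m1 m2 : ℕ) (θ : ℝ × ℝ) : polM2 m1 m2 θ ∈ Set.Icc (0 : ℝ) 1 := by
  have h1 : 0 ≤ m1 * exp θ.1 := by positivity
  have h2 : 0 ≤ m2 * exp θ.2 := by positivity
  exact ⟨div_nonneg h2 (by positivity), div_le_one_of_le₀ (by linarith) (by positivity)⟩

lemma polM1_le {m2 : ℕ} (m1 : ℕ) (hm2 : 1 ≤ m2) (θ : ℝ × ℝ) :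
    polM1 m1 m2 θ ≤ m1 * exp (θ.1 - θ.2) / m2 := by
  have hm : (0 : ℝ) < m2 := by exact_mod_cast hm2
  calc polM1 m1 m2 θ ≤ m1 * exp θ.1 / (m2 * exp θ.2) :=
        div_le_div_of_nonneg_left (by positivity) (by positivity)
          (le_add_of_nonneg_left (by positivity))
    _ = m1 * exp (θ.1 - θ.2) / m2 := by rw [exp_sub]; field_simp

/-- If some mixed query was answered with a category-2 message, the parameter gap of any policy at
least as good as the uniform one is bounded independently of the category sizes. -/
lemma sub_le_of_slicLoss_le {m1 m2 : ℕ} {ζ β δ : ℝ} (hζ : ζ ∈ Set.Ioo (0 : ℝ) 1) (hβ : 0 < β)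
    (hδ : 0 < δ) {n : ℕ} {d : Fin n → (Fin 2 → Bool) × Bool} {i : Fin n}
    (hi : catCount (d i).1 = 1) (hi2 : (d i).2 = false) {θ : ℝ × ℝ}
    (hθ : slicLoss m1 m2 ζ β δ d θ ≤ slicLoss m1 m2 ζ β δ d 0) :
    θ.1 - θ.2 ≤ n * δ + β * (1 - log ζ - log (1 - ζ)) := by
  obtain ⟨hζ0, hζ1⟩ := hζ
  have hinge_zero : (∑ i, if catCount (d i).1 = 1
      then max 0 ((if (d i).2 then (0 : ℝ × ℝ).2 - (0 : ℝ × ℝ).1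
        else (0 : ℝ × ℝ).1 - (0 : ℝ × ℝ).2) + δ)
      else max 0 (0 + δ)) = n * δ := by
    simp [hδ.le]
  have hinge : θ.1 - θ.2 + δ ≤ ∑ i, if catCount (d i).1 = 1
      then max 0 ((if (d i).2 then θ.2 - θ.1 else θ.1 - θ.2) + δ)
      else max 0 (0 + δ) := by
    refine le_trans ?_ (Finset.single_le_sum (fun j _ => ?_) (Finset.mem_univ i))
    · simp [hi, hi2]
    · split_ifs <;> exact le_max_left _ _
  have kl_zero : polM1 m1 m2 0 * log (polM1 m1 m2 0 / ζ) +
      polM2 m1 m2 0 * log (polM2 m1 m2 0 / (1 - ζ)) ≤ -log ζ - log (1 - ζ) := by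
    have h1 := polM1_mem_Icc m1 m2 0
    have h2 := polM2_mem_Icc m1 m2 0
    have := mul_log_div_le_neg_log h1.1 h1.2 hζ0 hζ1.le
    have := mul_log_div_le_neg_log h2.1 h2.2 (sub_pos.2 hζ1) (by linarith)
    linarith
  have kl : -1 ≤ polM1 m1 m2 θ * log (polM1 m1 m2 θ / ζ) +
      polM2 m1 m2 θ * log (polM2 m1 m2 θ / (1 - ζ)) := by
    have h1 := (polM1_mem_Icc m1 m2 θ).1
    have h2 := (polM2_mem_Icc m1 m2 θ).1
    have := sub_le_mul_log_div h1 hζ0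
    have := sub_le_mul_log_div h2 (sub_pos.2 hζ1)
    linarith
  unfold slicLoss at hθ
  rw [hinge_zero] at hθ
  have := mul_le_mul_of_nonneg_left kl_zero hβ.le
  have := mul_le_mul_of_nonneg_left kl hβ.le
  linarith

lemma chooseCat1Prob_mem_Icc {k : ℕ} {p1 : ℝ} (hp : p1 ∈ Set.Icc (0 : ℝ) 1) (v : Fin k → Bool) :
    chooseCat1Prob p1 v ∈ Set.Icc (0 : ℝ) 1 := by
  unfold chooseCat1Prob
  split_ifs
  · simp
  · exact hp
  · simp

lemma datumProb_nonneg {k : ℕ} {ζ p1 : ℝ} (hζ : ζ ∈ Set.Icc (0 : ℝ) 1)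
    (hp : p1 ∈ Set.Icc (0 : ℝ) 1) (d : (Fin k → Bool) × Bool) : 0 ≤ datumProb ζ p1 d := by
  have h := chooseCat1Prob_mem_Icc hp d.1
  refine mul_nonneg (Finset.prod_nonneg fun j _ => ?_) ?_
  · split_ifs
    exacts [hζ.1, sub_nonneg.2 hζ.2]
  · split_ifs
    exacts [h.1, sub_nonneg.2 h.2]

lemma sum_datumProb (k : ℕ) (ζ p1 : ℝ) : ∑ d : (Fin k → Bool) × Bool, datumProb ζ p1 d = 1 := by
  have h := Finset.prod_univ_sum (fun _ : Fin k => (Finset.univ : Finset Bool))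
    (fun _ b => if b then ζ else 1 - ζ)
  rw [Fintype.piFinset_univ] at h
  simp only [Fintype.sum_bool, if_true, Bool.false_eq_true, if_false, add_sub_cancel,
    Finset.prod_const_one] at h
  simp only [Fintype.sum_prod_type, Fintype.sum_bool, datumProb, if_true, Bool.false_eq_true,
    if_false, ← mul_add, add_sub_cancel, mul_one]
  exact h.symm

/-- The probability that an i.i.d. sample from a finite type misses a given value. -/
lemma measure_forall_ne_le {Ω α : Type*} [MeasurableSpace Ω] [Fintype α] [DecidableEq α]
    (μ : Measure Ω) {p : α → ℝ} (hp : ∀ a, 0 ≤ p a) (hp1 : ∑ a, p a = 1) {n : ℕ}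
    (D : Fin n → Ω → α)
    (hD : ∀ d : Fin n → α, μ {ω | ∀ i, D i ω = d i} = ENNReal.ofReal (∏ i, p (d i))) (a : α) :
    μ {ω | ∀ i, D i ω ≠ a} ≤ ENNReal.ofReal ((1 - p a) ^ n) := by
  set S := Fintype.piFinset fun _ : Fin n => Finset.univ.erase a
  have hsub : {ω | ∀ i, D i ω ≠ a} ⊆ ⋃ d ∈ S, {ω | ∀ i, D i ω = d i} := by
    intro ω hω
    simp only [Set.mem_iUnion]
    exact ⟨fun i => D i ω, by simpa [S] using hω, fun i => rfl⟩
  calc μ {ω | ∀ i, D i ω ≠ a} ≤ ∑ d ∈ S, μ {ω | ∀ i, D i ω = d i} :=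
        (measure_mono hsub).trans (measure_biUnion_finset_le _ _)
    _ = ENNReal.ofReal (∑ d ∈ S, ∏ i, p (d i)) := by
        rw [ENNReal.ofReal_sum_of_nonneg fun d _ => Finset.prod_nonneg fun i _ => hp _]
        exact Finset.sum_congr rfl fun d _ => hD d
    _ = ENNReal.ofReal ((1 - p a) ^ n) := by
        rw [← Finset.prod_univ_sum (fun _ : Fin n => Finset.univ.erase a) fun _ => p,
          Finset.prod_const, Finset.card_univ, Fintype.card_fin, ← hp1,
          ← Finset.add_sum_erase _ _ (Finset.mem_univ a), add_sub_cancel_left]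

lemma datumProb_mixed_false (ζ p1 : ℝ) :
    datumProb ζ p1 (![true, false], false) = ζ * (1 - ζ) * (1 - p1) := by
  simp [datumProb, chooseCat1Prob, Fin.forall_fin_two, Fin.exists_fin_two]

lemma catCount_mixed : catCount ![true, false] = 1 := by
  decide

/-- **Proposition 4 (SLiC failure).**  Under the dichotomy data model with query
size `k = 2`, `ζ = P_π̄(M1) ∈ (0,1)` and `p*(1), p*(2) > 0`, with `k`, `ζ`, `p*`
and `M1` (of size `m1`) held fixed while `|M2| = m2` varies, let `θ̂ = θhat n m2`
minimize the SLiC loss for each dataset size `n` and each value of `m2`.  Then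
`lim_{n→∞} P( lim_{m2→∞} P_{π_θ̂}(M1) = 0 ) = 1`, the inner limit being taken
with the realized category/choice pattern of the dataset fixed. -/
theorem slic_failure
    (m1 : ℕ) (hm1 : 1 ≤ m1)
    (ζ p1 p2 β δ : ℝ) (hζ : ζ ∈ Set.Ioo (0:ℝ) 1)
    (hp1 : 0 < p1) (hp2 : 0 < p2) (hp : p1 + p2 = 1) (hβ : 0 < β) (hδ : 0 < δ)
    (Ω : Type*) [MeasurableSpace Ω] (μ : Measure Ω) [IsProbabilityMeasure μ]
    -- the dataset of size `n`: `n` i.i.d. pattern-level data (independent of `m2`)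
    (D : (n : ℕ) → Fin n → Ω → (Fin 2 → Bool) × Bool)
    (hiid : ∀ n (dd : Fin n → (Fin 2 → Bool) × Bool),
      μ {ω | ∀ i, D n i ω = dd i} = ENNReal.ofReal (∏ i, datumProb ζ p1 (dd i)))
    -- for each dataset size `n` and each size `m2` of `M2`, `θ̂` minimizes `L_SLiC`
    (θhat : (n : ℕ) → (m2 : ℕ) → Ω → ℝ × ℝ)
    (hθ : ∀ n m2, 1 ≤ m2 → ∀ ω θ',
      slicLoss m1 m2 ζ β δ (fun i => D n i ω) (θhat n m2 ω) ≤
        slicLoss m1 m2 ζ β δ (fun i => D n i ω) θ') :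
    Tendsto
      (fun n => μ {ω | Tendsto (fun m2 => polM1 m1 m2 (θhat n m2 ω)) atTop (nhds 0)})
      atTop (nhds 1) := by
  set a : (Fin 2 → Bool) × Bool := (![true, false], false)
  have hζ' : ζ ∈ Set.Icc (0 : ℝ) 1 := Set.Ioo_subset_Icc_self hζ
  have hp1' : p1 ∈ Set.Icc (0 : ℝ) 1 := ⟨hp1.le, by linarith⟩
  have hnonneg : ∀ d : (Fin 2 → Bool) × Bool, 0 ≤ datumProb ζ p1 d := datumProb_nonneg hζ' hp1'
  have hpos : 0 < datumProb ζ p1 a := by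
    rw [datumProb_mixed_false]
    exact mul_pos (mul_pos hζ.1 (sub_pos.2 hζ.2)) (by linarith)
  have hle : datumProb ζ p1 a ≤ 1 :=
    (Finset.single_le_sum (fun d _ => hnonneg d) (Finset.mem_univ a)).trans_eq
      (sum_datumProb 2 ζ p1)
  have hmem : ∀ n ω i, D n i ω = a →
      Tendsto (fun m2 => polM1 m1 m2 (θhat n m2 ω)) atTop (nhds 0) := by
    intro n ω i hi
    refine squeeze_zero' (Eventually.of_forall fun m2 => (polM1_mem_Icc m1 m2 _).1) ?_
      (tendsto_const_div_atTop_nhds_zero_nat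
        (m1 * exp (n * δ + β * (1 - log ζ - log (1 - ζ)))))
    filter_upwards [eventually_ge_atTop 1] with m2 hm2
    refine (polM1_le m1 hm2 _).trans ?_
    have := sub_le_of_slicLoss_le hζ hβ hδ (d := fun i => D n i ω) (i := i)
      (by rw [hi]; exact catCount_mixed) (by rw [hi]) (hθ n m2 hm2 ω 0)
    gcongr
  have hbound : ∀ n, 1 - ENNReal.ofReal ((1 - datumProb ζ p1 a) ^ n) ≤
      μ {ω | Tendsto (fun m2 => polM1 m1 m2 (θhat n m2 ω)) atTop (nhds 0)} := by
    intro n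
    rw [tsub_le_iff_right]
    calc 1 = μ Set.univ := measure_univ.symm
      _ ≤ μ ({ω | Tendsto (fun m2 => polM1 m1 m2 (θhat n m2 ω)) atTop (nhds 0)} ∪
            {ω | ∀ i, D n i ω ≠ a}) := by
          refine measure_mono fun ω _ => ?_
          by_cases h : ∃ i, D n i ω = a
          · exact Or.inl (h.elim fun i hi => hmem n ω i hi)
          · exact Or.inr (not_exists.1 h)
      _ ≤ _ := (measure_union_le _ _).trans (by
          gcongr
          exact measure_forall_ne_le μ hnonneg (sum_datumProb 2 ζ p1) (D n) (hiid n) a)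
  refine tendsto_of_tendsto_of_tendsto_of_le_of_le ?_ tendsto_const_nhds hbound
    fun n => prob_le_one
  have hpow := tendsto_pow_atTop_nhds_zero_of_lt_one (sub_nonneg.2 hle)
    (sub_lt_self 1 hpos)
  simpa using ENNReal.Tendsto.sub tendsto_const_nhds (ENNReal.tendsto_ofReal hpow)
    (Or.inl ENNReal.one_ne_top)
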